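/- For any two subsets S₁ and S₂ of the customer set {1,…,n} and any unitary cost c ≥ 0, the expected profit is supermodular: G(S₁,c) + G(S₂,c) ≤ G(S₁ ∪ S₂,c) + G(S₁ ∩ S₂,c). -/

import Mathlib

open Finset

/-- Expected revenue of a set of customers. -/
def R (pi p : ℕ → ℝ) (S : Finset ℕ) : ℝ := ∑ i ∈ S, pi i * p i

/-- Expected traveled distance (with l i = 2 * x i). -/
def L (x pi : ℕ → ℝ) (S : Finset ℕ) : ℝ :=
  ∑ i ∈ S, (2 * x i) * pi i * ∏ j ∈ S.filter (fun j => i < j), (1 - pi j)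

/-- Expected profit at unitary cost c. -/
def G (x pi p : ℕ → ℝ) (S : Finset ℕ) (c : ℝ) : ℝ := R pi p S - c * L x pi S

/-- Optimal value of the probabilistic profitable tour problem on a line. -/
def PPTP (n : ℕ) (x pi p : ℕ → ℝ) (c : ℝ) : ℝ :=
  (Finset.Icc 1 n).powerset.sup' (Finset.powerset_nonempty _) (fun S => G x pi p S c)

theorem L_insert_of_forall_lt (x pi : ℕ → ℝ) {a : ℕ} {S : Finset ℕ} (h : ∀ i ∈ S, i < a) :
    L x pi (insert a S) = 2 * x a * pi a + (1 - pi a) * L x pi S := by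
  have ha : a ∉ S := fun hs => lt_irrefl a (h a hs)
  have hempty : (insert a S).filter (fun j => a < j) = ∅ := by
    ext j
    simp only [mem_filter, mem_insert, notMem_empty, iff_false, not_and, not_lt]
    rintro (rfl | hj)
    · exact le_rfl
    · exact (h j hj).le
  unfold L
  rw [sum_insert ha, hempty, prod_empty, mul_one, mul_sum]
  congr 1
  refine sum_congr rfl fun i hi => ?_
  rw [filter_insert, if_pos (h i hi), prod_insert (by simp [ha])]
  ring

theorem L_le_two_mul {x pi : ℕ → ℝ} {M : ℝ} (hM : 0 ≤ M) (S : Finset ℕ)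
    (hx : ∀ i ∈ S, x i ≤ M) (hpi : ∀ i ∈ S, 0 ≤ pi i ∧ pi i ≤ 1) : L x pi S ≤ 2 * M := by
  induction S using Finset.induction_on_max with
  | empty => simpa [L] using hM
  | insert a S h ih =>
    rw [forall_mem_insert] at hx hpi
    rw [L_insert_of_forall_lt x pi h]
    have := ih hx.2 hpi.2
    nlinarith [mul_le_mul_of_nonneg_left this (sub_nonneg.2 hpi.1.2),
      mul_le_mul_of_nonneg_left hx.1 hpi.1.1]

theorem subset_insert_cases {a : ℕ} {S U : Finset ℕ} (h : S ⊆ insert a U) :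
    S ⊆ U ∨ ∃ S' ⊆ U, S = insert a S' := by
  by_cases ha : a ∈ S
  · exact Or.inr ⟨S.erase a, subset_insert_iff.1 h, (insert_erase ha).symm⟩
  · exact Or.inl ((subset_insert_iff_of_notMem ha).1 h)

theorem L_mono {x pi : ℕ → ℝ} {S T : Finset ℕ} (hST : S ⊆ T) (hx : ∀ i ∈ T, 0 ≤ x i)
    (hmono : MonotoneOn x T) (hpi : ∀ i ∈ T, 0 ≤ pi i ∧ pi i ≤ 1) : L x pi S ≤ L x pi T := by
  induction T using Finset.induction_on_max generalizing S with
  | empty => rw [subset_empty.1 hST]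
  | insert a T h ih =>
    have hmono' : MonotoneOn x T := hmono.mono (by simp)
    have hle : ∀ i ∈ T, x i ≤ x a := fun i hi =>
      hmono (by simp [hi]) (by simp) (h i hi).le
    rw [forall_mem_insert] at hx hpi
    rw [L_insert_of_forall_lt x pi h]
    rcases subset_insert_cases hST with hS | ⟨S, hS, rfl⟩
    · have h1 := ih hS hx.2 hmono' hpi.2
      have h2 := L_le_two_mul hx.1 T hle hpi.2
      nlinarith [mul_le_mul_of_nonneg_left h2 hpi.1.1]
    · rw [L_insert_of_forall_lt x pi fun i hi => h i (hS hi)]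
      have h1 := ih hS hx.2 hmono' hpi.2
      nlinarith [mul_le_mul_of_nonneg_left h1 (sub_nonneg.2 hpi.1.2)]

theorem L_union_add_inter_le {x pi : ℕ → ℝ} {S T U : Finset ℕ} (hSU : S ⊆ U) (hTU : T ⊆ U)
    (hx : ∀ i ∈ U, 0 ≤ x i) (hmono : MonotoneOn x U) (hpi : ∀ i ∈ U, 0 ≤ pi i ∧ pi i ≤ 1) :
    L x pi (S ∪ T) + L x pi (S ∩ T) ≤ L x pi S + L x pi T := by
  induction U using Finset.induction_on_max generalizing S T with
  | empty => simp [subset_empty.1 hSU, subset_empty.1 hTU]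
  | insert a U h ih =>
    have hmono' : MonotoneOn x U := hmono.mono (by simp)
    rw [forall_mem_insert] at hx hpi
    have ha : a ∉ U := fun hs => lt_irrefl a (h a hs)
    have hins : ∀ V ⊆ U, L x pi (insert a V) = 2 * x a * pi a + (1 - pi a) * L x pi V :=
      fun V hV => L_insert_of_forall_lt x pi fun i hi => h i (hV hi)
    have hle : ∀ V W : Finset ℕ, V ⊆ W → W ⊆ U → L x pi V ≤ L x pi W := fun V W hVW hW =>
      L_mono hVW (fun i hi => hx.2 i (hW hi)) (hmono'.mono (coe_subset.2 hW))
        fun i hi => hpi.2 i (hW hi)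
    rcases subset_insert_cases hSU with hS | ⟨S, hS, rfl⟩ <;>
      rcases subset_insert_cases hTU with hT | ⟨T, hT, rfl⟩ <;>
      have key := ih hS hT hx.2 hmono' hpi.2
    · exact key
    · rw [union_insert, inter_insert_of_notMem fun hs => ha (hS hs),
        hins _ (union_subset hS hT), hins T hT]
      nlinarith [mul_le_mul_of_nonneg_left
        (hle T (S ∪ T) subset_union_right (union_subset hS hT)) hpi.1.1]
    · rw [insert_union, insert_inter_of_notMem fun hs => ha (hT hs),
        hins _ (union_subset hS hT), hins S hS]
      nlinarith [mul_le_mul_of_nonneg_left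
        (hle S (S ∪ T) subset_union_left (union_subset hS hT)) hpi.1.1]
    · rw [← insert_union_distrib, ← insert_inter_distrib, hins _ (union_subset hS hT),
        hins _ (inter_subset_left.trans hS), hins S hS, hins T hT]
      nlinarith [mul_le_mul_of_nonneg_left key (sub_nonneg.2 hpi.1.2)]

theorem stmt6 (n : ℕ) (x p pi : ℕ → ℝ)
    (hx : ∀ i ∈ Finset.Icc 1 n, 0 < x i)
    (hxmono : ∀ i, 1 ≤ i → i + 1 ≤ n → x i ≤ x (i + 1))
    (hp : ∀ i ∈ Finset.Icc 1 n, 0 < p i)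
    (hpi : ∀ i ∈ Finset.Icc 1 n, 0 < pi i ∧ pi i ≤ 1)
    (S₁ S₂ : Finset ℕ) (hS₁ : S₁ ⊆ Finset.Icc 1 n) (hS₂ : S₂ ⊆ Finset.Icc 1 n)
    (c : ℝ) (hc : 0 ≤ c) :
    G x pi p S₁ c + G x pi p S₂ c ≤ G x pi p (S₁ ∪ S₂) c + G x pi p (S₁ ∩ S₂) c := by
  have hmono : MonotoneOn x (Finset.Icc 1 n : Finset ℕ) := by
    intro i hi j hj hij
    simp only [coe_Icc, Set.mem_Icc] at hi hj
    induction j, hij using Nat.le_induction with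
    | base => exact le_rfl
    | succ k hk ih =>
      exact (ih ⟨hi.1.trans hk, by omega⟩).trans (hxmono k (hi.1.trans hk) hj.2)
  have hL := L_union_add_inter_le hS₁ hS₂ (fun i hi => (hx i hi).le) hmono
    fun i hi => ⟨(hpi i hi).1.le, (hpi i hi).2⟩
  have hR : R pi p (S₁ ∪ S₂) + R pi p (S₁ ∩ S₂) = R pi p S₁ + R pi p S₂ :=
    sum_union_inter
  unfold G
  nlinarith [mul_le_mul_of_nonneg_left hL hc]
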